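/- Let w(x) = (1−x²)^{3/2} on (−1,1), let {p_n} be the monic orthogonal polynomials for w, and let W(x) = (1−x²)^{1/2}·[[3, 3x, 4x²−1],[3x, x²+2, 3x],[4x²−1, 3x, 3]] on (−1,1). Then the sequence of 3×3 matrix polynomials R_n(x) = [[x p_n′(x), −2p_n′(x), x p_n′(x) + 4p_n(x)],[−p_n′(x) − p_n(x), 2x p_n′(x) + 2p_n(x), −p_n′(x) + p_n(x)],[−p_n(x), 0, p_n(x)]] is a sequence of matrix orthogonal polynomials with respect to W: each R_n has degree n with invertible leading coefficient, and ⟨R_n, R_m⟩_W = 0 for n ≠ m. -/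

import Mathlib

open MeasureTheory Filter Polynomial Matrix
open scoped ComplexOrder

noncomputable section

/-- A matrix polynomial. -/
abbrev MatPoly (n m : ℕ) := Matrix (Fin n) (Fin m) (Polynomial ℂ)

/-- Evaluation of a matrix polynomial at a real point. -/
def evalM {n m : ℕ} (P : MatPoly n m) (x : ℝ) : Matrix (Fin n) (Fin m) ℂ :=
  Matrix.of fun i j => (P i j).eval (x : ℂ)

/-- Entrywise `j`-th derivative of a matrix polynomial. -/
def derivM {n m : ℕ} (j : ℕ) (P : MatPoly n m) : MatPoly n m :=
  Matrix.of fun i k => (⇑Polynomial.derivative)^[j] (P i k)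

/-- A constant matrix, viewed as a matrix polynomial. -/
def cmap {n m : ℕ} (A : Matrix (Fin n) (Fin m) ℂ) : MatPoly n m :=
  A.map Polynomial.C

/-- A matrix differential operator with polynomial coefficients,
`D = ∑_{j ≤ order} ∂^j F_j`, acting on the right. -/
structure MatDiffOp (n m : ℕ) where
  order : ℕ
  coeff : ℕ → MatPoly n m
  coeff_eq_zero : ∀ j, order < j → coeff j = 0

/-- The right action `(P · D)(x) = ∑_j P^{(j)}(x) F_j(x)`. -/
def MatDiffOp.act {k n m : ℕ} (P : MatPoly k n) (D : MatDiffOp n m) : MatPoly k m :=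
  ∑ j ∈ Finset.range (D.order + 1), derivM j P * D.coeff j

/-- The action `f · D = ∑_j f^{(j)} F_j` on a scalar polynomial. -/
def MatDiffOp.sact {n m : ℕ} (D : MatDiffOp n m) (f : Polynomial ℂ) : MatPoly n m :=
  ∑ j ∈ Finset.range (D.order + 1), ((⇑Polynomial.derivative)^[j] f) • D.coeff j

/-- A weight matrix on the set `s`: smooth, a.e. positive definite, with finite moments. -/
structure IsWeight (s : Set ℝ) {N : ℕ} (W : ℝ → Matrix (Fin N) (Fin N) ℂ) : Prop where
  smooth : ∀ i j, ContDiffOn ℝ (⊤ : ℕ∞) (fun x => W x i j) s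
  posdef : ∀ᵐ x ∂(volume.restrict s), (W x).PosDef
  moments : ∀ (k : ℕ) (i j : Fin N), IntegrableOn (fun x : ℝ => (x : ℂ) ^ k * W x i j) s

/-- `∑_j W^{(j)}(x) F_j(x)` for a differential operator `D` with coefficients `F_j`. -/
def weightSide {N : ℕ} (W : ℝ → Matrix (Fin N) (Fin N) ℂ) (D : MatDiffOp N N) (x : ℝ) :
    Matrix (Fin N) (Fin N) ℂ :=
  ∑ j ∈ Finset.range (D.order + 1),
    (Matrix.of fun i k => iteratedDeriv j (fun t => W t i k) x) * evalM (D.coeff j) x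

/-- The weight `W` is good enough. -/
def GoodEnough (s : Set ℝ) {N : ℕ} (W : ℝ → Matrix (Fin N) (Fin N) ℂ) : Prop :=
  ∀ (A : MatPoly N N) (D : MatDiffOp N N),
    (∀ (P : MatPoly N N) (i j : Fin N),
        IntegrableOn (fun x => (evalM P x * (evalM A x * W x)) i j) s ∧
        IntegrableOn (fun x => (evalM P x * weightSide W D x) i j) s ∧
        ∫ x in s, (evalM P x * (evalM A x * W x)) i j =
          ∫ x in s, (evalM P x * weightSide W D x) i j) →
    ∀ x ∈ s, evalM A x * W x = weightSide W D x

/-- The matrix inner product `⟨P, Q⟩_W = ∫ P W Q^*`. -/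
def innerW (s : Set ℝ) {N a b : ℕ} (W : ℝ → Matrix (Fin N) (Fin N) ℂ)
    (P : MatPoly a N) (Q : MatPoly b N) : Matrix (Fin a) (Fin b) ℂ :=
  Matrix.of fun i j => ∫ x in s, (evalM P x * W x * (evalM Q x)ᴴ) i j

/-- A sequence of matrix orthogonal polynomials with respect to `W` on `s`. -/
structure IsMOP (s : Set ℝ) {N : ℕ} (W : ℝ → Matrix (Fin N) (Fin N) ℂ)
    (P : ℕ → MatPoly N N) : Prop where
  degree_le : ∀ n (i j : Fin N), ((P n) i j).natDegree ≤ n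
  lead_unit : ∀ n, IsUnit (Matrix.of fun i j : Fin N => ((P n) i j).coeff n)
  integrable : ∀ n m (i j : Fin N),
    IntegrableOn (fun x => (evalM (P n) x * W x * (evalM (P m) x)ᴴ) i j) s
  orthogonal : ∀ n m, n ≠ m → innerW s W (P n) (P m) = 0

/-- Membership in the algebra `𝒟(W)` (relative to the MOP sequence `P`). -/
def InDW {N : ℕ} (P : ℕ → MatPoly N N) (D : MatDiffOp N N) : Prop :=
  ∀ n, ∃ Λ : Matrix (Fin N) (Fin N) ℂ, MatDiffOp.act (P n) D = cmap Λ * P n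

/-- Membership in the module `𝒟(W, W̃)` (relative to the MOP sequences `P`, `Q`). -/
def InDWW {N1 N2 : ℕ} (P : ℕ → MatPoly N1 N1) (Q : ℕ → MatPoly N2 N2)
    (T : MatDiffOp N1 N2) : Prop :=
  ∀ n, ∃ A : Matrix (Fin N1) (Fin N2) ℂ, MatDiffOp.act (P n) T = cmap A * Q n

/-- A matrix polynomial has degree (exactly) `d`. -/
def hasDeg {n m : ℕ} (P : MatPoly n m) (d : ℕ) : Prop :=
  (∀ i j, (P i j).degree ≤ (d : WithBot ℕ)) ∧ ∃ i j, (P i j).degree = (d : WithBot ℕ)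

/-- A degree-preserving differential operator. -/
def DegreePreserving {n m : ℕ} (D : MatDiffOp n m) : Prop :=
  ∀ᶠ d in (atTop : Filter ℕ), ∀ f : Polynomial ℂ, f.degree = ((d : ℕ) : WithBot ℕ) → hasDeg (D.sact f) d

/-- `Q` is a Darboux transformation of `P`. -/
def IsDarboux {N : ℕ} (P Q : ℕ → MatPoly N N) : Prop :=
  ∃ (V Nop D : MatDiffOp N N) (A : ℕ → Matrix (Fin N) (Fin N) ℂ),
    DegreePreserving V ∧ DegreePreserving Nop ∧
    (∀ R : MatPoly N N, MatDiffOp.act R D = MatDiffOp.act (MatDiffOp.act R V) Nop) ∧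
    InDW P D ∧
    (∀ n, MatDiffOp.act (P n) V = cmap (A n) * Q n)
/-- The first-order operator `∂ F₁ + F₀`. -/
def op1 {n m : ℕ} (F0 F1 : MatPoly n m) : MatDiffOp n m where
  order := 1
  coeff j := if j = 0 then F0 else if j = 1 then F1 else 0
  coeff_eq_zero j hj := by
    have h0 : j ≠ 0 := by omega
    have h1 : j ≠ 1 := by omega
    simp [h0, h1]

/-- The zeroth-order operator `F₀`. -/
def op0 {n m : ℕ} (F0 : MatPoly n m) : MatDiffOp n m where
  order := 0
  coeff j := if j = 0 then F0 else 0
  coeff_eq_zero j hj := by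
    have h0 : j ≠ 0 := by omega
    simp [h0]

/-- The scalar Jacobi weight `(1 - x²)^{3/2}` on `(-1, 1)`. -/
def jacw (x : ℝ) : ℝ := (1 - x ^ 2) ^ ((3 : ℝ) / 2)

/-- The 3×3 Jacobi-type matrix weight of Example 1. -/
def jacW (x : ℝ) : Matrix (Fin 3) (Fin 3) ℂ :=
  (((1 - x ^ 2) ^ ((1 : ℝ) / 2) : ℝ) : ℂ) •
    !![3, 3 * (x : ℂ), 4 * (x : ℂ) ^ 2 - 1;
       3 * (x : ℂ), (x : ℂ) ^ 2 + 2, 3 * (x : ℂ);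
       4 * (x : ℂ) ^ 2 - 1, 3 * (x : ℂ), 3]

/-- `p` is the sequence of monic orthogonal polynomials for `(1 - x²)^{3/2}` on `(-1, 1)`. -/
def IsJacobiSeq (p : ℕ → Polynomial ℂ) : Prop :=
  ∀ n : ℕ, (p n).Monic ∧ (p n).natDegree = n ∧
    ∀ k < n, ∫ x in Set.Ioo (-1 : ℝ) 1,
      (p n).eval (x : ℂ) * (x : ℂ) ^ k * ((jacw x : ℝ) : ℂ) = 0
/-- The square root weight `(1 - x²)^{1/2}`. -/
def sqrtWeight (x : ℝ) : ℝ := (1 - x ^ 2) ^ ((1 : ℝ) / 2)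

lemma continuous_sqrtWeight : Continuous sqrtWeight :=
  (by fun_prop : Continuous fun x : ℝ => 1 - x ^ 2).rpow_const fun _ => Or.inr (by norm_num)

lemma jacw_eq_mul_sqrtWeight {x : ℝ} (hx : x ∈ Set.Ioo (-1 : ℝ) 1) :
    jacw x = (1 - x ^ 2) * sqrtWeight x := by
  have hpos : 0 < 1 - x ^ 2 := by nlinarith [hx.1, hx.2]
  rw [jacw, sqrtWeight, show (3 : ℝ) / 2 = 1 + 1 / 2 by norm_num, Real.rpow_add hpos,
    Real.rpow_one]

lemma continuous_eval_mul_sqrtWeight (F : ℂ[X]) :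
    Continuous fun x : ℝ => F.eval (x : ℂ) * (sqrtWeight x : ℂ) :=
  (F.continuous.comp Complex.continuous_ofReal).mul
    (Complex.continuous_ofReal.comp continuous_sqrtWeight)

lemma integrableOn_eval_mul_sqrtWeight (F : ℂ[X]) :
    IntegrableOn (fun x : ℝ => F.eval (x : ℂ) * (sqrtWeight x : ℂ)) (Set.Ioo (-1) 1) :=
  ((continuous_eval_mul_sqrtWeight F).continuousOn.integrableOn_Icc).mono_set
    Set.Ioo_subset_Icc_self

/-- Integration of polynomials against `(1 - x²)^{1/2}` on `(-1, 1)`. -/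
def sqrtMoment : ℂ[X] →ₗ[ℂ] ℂ where
  toFun F := ∫ x in Set.Ioo (-1 : ℝ) 1, F.eval (x : ℂ) * (sqrtWeight x : ℂ)
  map_add' F G := by
    simp only [eval_add, add_mul]
    exact integral_add (integrableOn_eval_mul_sqrtWeight F) (integrableOn_eval_mul_sqrtWeight G)
  map_smul' c F := by
    simp only [eval_smul, smul_eq_mul, mul_assoc, RingHom.id_apply]
    exact integral_const_mul c _

lemma hasDerivAt_jacw (x : ℝ) : HasDerivAt jacw (-3 * x * sqrtWeight x) x := by
  have h : HasDerivAt jacw (-(↑2 * x ^ (2 - 1)) * (3 / 2) * (1 - x ^ 2) ^ ((3 : ℝ) / 2 - 1)) x :=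
    ((hasDerivAt_pow 2 x).const_sub 1).rpow_const (Or.inr (by norm_num))
  have he : -3 * x * sqrtWeight x =
      -(↑2 * x ^ (2 - 1)) * (3 / 2) * (1 - x ^ 2) ^ ((3 : ℝ) / 2 - 1) := by
    rw [sqrtWeight, show (3 : ℝ) / 2 - 1 = 1 / 2 by norm_num]
    ring
  rwa [he]

/-- The total derivative of `h (1 - x²)^{3/2}` integrates to zero. -/
lemma sqrtMoment_derivative (h : ℂ[X]) :
    sqrtMoment ((1 - X ^ 2) * derivative h - 3 * X * h) = 0 := by
  change ∫ x in Set.Ioo (-1 : ℝ) 1, _ = _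
  rw [← integral_Ioc_eq_integral_Ioo, ← intervalIntegral.integral_of_le (by norm_num)]
  have hd (x : ℝ) : HasDerivAt (fun x : ℝ => h.eval (x : ℂ) * (jacw x : ℂ))
      ((derivative h).eval (x : ℂ) * (jacw x : ℂ) +
        h.eval (x : ℂ) * ((-3 * x * sqrtWeight x : ℝ) : ℂ)) x :=
    (h.hasDerivAt (x : ℂ)).comp_ofReal.mul (hasDerivAt_jacw x).ofReal_comp
  rw [intervalIntegral.integral_eq_sub_of_hasDerivAt_of_le
    (f := fun x : ℝ => h.eval (x : ℂ) * (jacw x : ℂ)) (by norm_num)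
    (fun x _ => (hd x).continuousAt.continuousWithinAt)]
  · simp [jacw]
  · intro x hx
    refine (hd x).congr_deriv ?_
    rw [jacw_eq_mul_sqrtWeight hx]
    simp only [eval_sub, eval_mul, eval_one, eval_pow, eval_X, eval_ofNat]
    push_cast
    ring
  · exact (continuous_eval_mul_sqrtWeight _).intervalIntegrable _ _

lemma sqrtMoment_mul_eq_integral_jacw (F : ℂ[X]) :
    sqrtMoment ((1 - X ^ 2) * F) =
      ∫ x in Set.Ioo (-1 : ℝ) 1, F.eval (x : ℂ) * (jacw x : ℂ) := by
  refine setIntegral_congr_fun measurableSet_Ioo fun x hx => ?_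
  simp only [jacw_eq_mul_sqrtWeight hx, eval_sub, eval_mul, eval_one, eval_pow, eval_X]
  push_cast
  ring

lemma IsJacobiSeq.sqrtMoment_eq_zero {p : ℕ → ℂ[X]} (hp : IsJacobiSeq p) {n : ℕ} {F : ℂ[X]}
    (hF : F.natDegree < n) : sqrtMoment ((1 - X ^ 2) * (p n * F)) = 0 := by
  rw [F.as_sum_range' n hF, Finset.mul_sum, Finset.mul_sum, map_sum]
  refine Finset.sum_eq_zero fun k hk => ?_
  rw [← C_mul_X_pow_eq_monomial, ← smul_eq_C_mul, mul_smul_comm, mul_smul_comm, map_smul,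
    sqrtMoment_mul_eq_integral_jacw]
  have := (hp n).2.2 k (Finset.mem_range.mp hk)
  simp only [eval_mul, eval_pow, eval_X, this, smul_zero]

lemma IsJacobiSeq.map_conj {p : ℕ → ℂ[X]} (hp : IsJacobiSeq p) :
    IsJacobiSeq fun n => (p n).map (starRingEnd ℂ) := by
  intro n
  refine ⟨(hp n).1.map _, by rw [natDegree_map, (hp n).2.1], fun k hk => ?_⟩
  rw [← map_zero (starRingEnd ℂ), ← (hp n).2.2 k hk, ← integral_conj]
  refine integral_congr_ae (.of_forall fun x => ?_)
  have : ((p n).map (starRingEnd ℂ)).eval (x : ℂ) = starRingEnd ℂ ((p n).eval (x : ℂ)) := by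
    rw [← eval_map_apply, Complex.conj_ofReal]
  simp [this]

lemma natDegree_gegenbauer_le (q : ℂ[X]) :
    ((1 - X ^ 2) * derivative (derivative q) - 5 * X * derivative q).natDegree
      ≤ q.natDegree := by
  have h1 := natDegree_derivative_le q
  have h2 := natDegree_derivative_le (derivative q)
  rcases Nat.eq_zero_or_pos q.natDegree with h0 | h0
  · rw [eq_C_of_natDegree_eq_zero h0]
    simp
  · have hX : (5 * X : ℂ[X]).natDegree ≤ 1 := by compute_degree
    refine (natDegree_sub_le _ _).trans (max_le ?_ ?_)
    · rcases Nat.eq_zero_or_pos (derivative q).natDegree with h3 | h3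
      · rw [eq_C_of_natDegree_eq_zero h3]
        simp
      · have hU : (1 - X ^ 2 : ℂ[X]).natDegree ≤ 2 := by compute_degree
        exact natDegree_mul_le.trans (by omega)
    · exact natDegree_mul_le.trans (by omega)

/-- The derivatives of the Jacobi polynomials are orthogonal for `(1 - x²)^{5/2}`. -/
lemma IsJacobiSeq.sqrtMoment_derivative_mul_of_lt {p q : ℕ → ℂ[X]} (hp : IsJacobiSeq p)
    (hq : IsJacobiSeq q) {n m : ℕ} (h : m < n) :
    sqrtMoment ((1 - X ^ 2) ^ 2 * (derivative (p n) * derivative (q m))) = 0 := by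
  have hdeg := natDegree_gegenbauer_le (q m)
  rw [(hq m).2.1] at hdeg
  have h1 := hp.sqrtMoment_eq_zero (hdeg.trans_lt h)
  have h2 := sqrtMoment_derivative ((1 - X ^ 2) * (p n * derivative (q m)))
  rw [← sub_eq_zero.mpr (h2.trans h1.symm), ← map_sub]
  congr 1
  simp only [derivative_mul, derivative_sub, derivative_one, derivative_X_pow,
    Nat.cast_ofNat, map_ofNat]
  ring

lemma IsJacobiSeq.sqrtMoment_combination {p q : ℕ → ℂ[X]} (hp : IsJacobiSeq p)
    (hq : IsJacobiSeq q) {n m : ℕ} (hnm : n ≠ m) (a b : ℂ) (h : ℂ[X]) :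
    sqrtMoment (C a * ((1 - X ^ 2) ^ 2 * (derivative (p n) * derivative (q m))) +
      C b * ((1 - X ^ 2) * (p n * q m)) +
      ((1 - X ^ 2) * derivative h - 3 * X * h)) = 0 := by
  have h1 : sqrtMoment ((1 - X ^ 2) * (p n * q m)) = 0 := by
    rcases hnm.lt_or_gt with hlt | hgt
    · rw [mul_comm (p n)]
      exact hq.sqrtMoment_eq_zero (by rwa [(hp n).2.1])
    · exact hp.sqrtMoment_eq_zero (by rwa [(hq m).2.1])
  have h2 : sqrtMoment ((1 - X ^ 2) ^ 2 * (derivative (p n) * derivative (q m))) = 0 := by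
    rcases hnm.lt_or_gt with hlt | hgt
    · rw [mul_comm (derivative (p n))]
      exact hq.sqrtMoment_derivative_mul_of_lt hp hlt
    · exact hp.sqrtMoment_derivative_mul_of_lt hq hgt
  rw [map_add, map_add, sqrtMoment_derivative, ← smul_eq_C_mul, ← smul_eq_C_mul, map_smul,
    map_smul, h1, h2]
  simp

/-- The polynomial factor of `jacW`. -/
def jacPoly : MatPoly 3 3 :=
  !![3, 3 * X, 4 * X ^ 2 - 1; 3 * X, X ^ 2 + 2, 3 * X; 4 * X ^ 2 - 1, 3 * X, 3]

/-- The conjugate transpose of a matrix polynomial of a real variable. -/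
def conjTransposeM {n m : ℕ} (P : MatPoly n m) : MatPoly m n :=
  Pᵀ.map (Polynomial.map (starRingEnd ℂ))

lemma evalM_mul {n m k : ℕ} (P : MatPoly n m) (Q : MatPoly m k) (x : ℝ) :
    evalM (P * Q) x = evalM P x * evalM Q x := by
  ext i j
  simp [evalM, Matrix.mul_apply, eval_finsetSum]

lemma evalM_conjTransposeM {n m : ℕ} (P : MatPoly n m) (x : ℝ) :
    evalM (conjTransposeM P) x = (evalM P x)ᴴ := by
  ext i j
  change ((P j i).map (starRingEnd ℂ)).eval (x : ℂ) = starRingEnd ℂ ((P j i).eval (x : ℂ))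
  rw [← eval_map_apply, Complex.conj_ofReal]

lemma jacW_eq_smul_evalM (x : ℝ) : jacW x = (sqrtWeight x : ℂ) • evalM jacPoly x := by
  rw [jacW, sqrtWeight]
  congr 1
  ext i j
  fin_cases i <;> fin_cases j <;> simp [evalM, jacPoly]

lemma evalM_mul_jacW_mul_apply {a b : ℕ} (P : MatPoly a 3) (Q : MatPoly b 3) (x : ℝ)
    (i : Fin a) (j : Fin b) :
    (evalM P x * jacW x * (evalM Q x)ᴴ) i j =
      ((P * jacPoly * conjTransposeM Q) i j).eval (x : ℂ) * (sqrtWeight x : ℂ) := by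
  rw [jacW_eq_smul_evalM, Matrix.mul_smul, Matrix.smul_mul, ← evalM_conjTransposeM,
    ← evalM_mul, ← evalM_mul, Matrix.smul_apply, smul_eq_mul, mul_comm]
  rfl

lemma innerW_jacW_apply {a b : ℕ} (P : MatPoly a 3) (Q : MatPoly b 3) (i : Fin a) (j : Fin b) :
    innerW (Set.Ioo (-1) 1) jacW P Q i j =
      sqrtMoment ((P * jacPoly * conjTransposeM Q) i j) := by
  simp only [innerW, of_apply, evalM_mul_jacW_mul_apply]
  rfl

/-- The matrix polynomial built from `f` whose value at the `n`-th Jacobi polynomial is the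
`n`-th matrix orthogonal polynomial for `jacW`. -/
def jacMatrix (f : ℂ[X]) : MatPoly 3 3 :=
  !![X * derivative f, -2 * derivative f, X * derivative f + 4 * f;
     -derivative f - f, 2 * X * derivative f + 2 * f, -derivative f + f;
     -f, 0, f]

/-- The coefficients expressing the Gram matrix of `jacMatrix f` and `jacMatrix g` through
`(1 - x²)² f' g'`, `(1 - x²) f g` and total derivatives. -/
lemma jacMatrix_mul_jacPoly_mul (f g : ℂ[X]) (i j : Fin 3) :
    ∃ (a b : ℂ) (h : ℂ[X]), (jacMatrix f * jacPoly *
        conjTransposeM (jacMatrix g)) i j =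
      C a * ((1 - X ^ 2) ^ 2 * (derivative f * derivative (g.map (starRingEnd ℂ)))) +
      C b * ((1 - X ^ 2) * (f * g.map (starRingEnd ℂ))) +
      ((1 - X ^ 2) * derivative h - 3 * X * h) := by
  obtain ⟨q, hq⟩ : ∃ q, q = g.map (starRingEnd ℂ) := ⟨_, rfl⟩
  have hdq : (derivative g).map (starRingEnd ℂ) = derivative q := by rw [hq, derivative_map]
  rw [← hq]
  refine ⟨!![8, 0, 0; 0, 4, 0; 0, 0, 0] i j, !![64, 16, 16; 16, 20, 8; 16, 8, 8] i j,
    (!![-16 * (X * (f * q)), -8 * (f * q), 0; -8 * (f * q), -4 * (X * (f * q)), 0; 0, 0, 0] :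
      MatPoly 3 3) i j, ?_⟩
  fin_cases i <;> fin_cases j <;>
    simp [jacMatrix, jacPoly, conjTransposeM, Matrix.mul_apply, Fin.sum_univ_three,
      derivative_mul, hdq, ← hq, map_ofNat C] <;>
    ring

lemma natDegree_jacMatrix_le (f : ℂ[X]) (i j : Fin 3) :
    (jacMatrix f i j).natDegree ≤ f.natDegree := by
  have hd : (derivative f).natDegree ≤ f.natDegree :=
    (natDegree_derivative_le f).trans (Nat.sub_le _ _)
  have hXd : (X * derivative f).natDegree ≤ f.natDegree := by
    rcases Nat.eq_zero_or_pos f.natDegree with h0 | h0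
    · rw [eq_C_of_natDegree_eq_zero h0]
      simp
    · have := natDegree_derivative_le f
      have hX : (X : ℂ[X]).natDegree ≤ 1 := natDegree_X_le
      exact natDegree_mul_le.trans (by omega)
  have h2 (r : ℂ[X]) (hr : r.natDegree ≤ f.natDegree) (c : ℂ) :
      (C c * r).natDegree ≤ f.natDegree := (natDegree_C_mul_le c r).trans hr
  fin_cases i <;> fin_cases j
  · exact hXd
  · have h := h2 _ hd (-2)
    rwa [map_neg, map_ofNat] at h
  · exact natDegree_add_le_of_degree_le hXd (h2 _ le_rfl 4)
  · exact (natDegree_sub_le _ _).trans (max_le ((natDegree_neg _).trans_le hd) le_rfl)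
  · refine natDegree_add_le_of_degree_le ?_ (h2 _ le_rfl 2)
    rw [mul_assoc]
    exact h2 _ hXd 2
  · exact natDegree_add_le_of_degree_le ((natDegree_neg _).trans_le hd) le_rfl
  · exact (natDegree_neg f).le
  · simp [jacMatrix]
  · exact le_rfl

lemma isUnit_coeff_jacMatrix {f : ℂ[X]} (hf : f.Monic) :
    IsUnit (Matrix.of fun i j : Fin 3 => (jacMatrix f i j).coeff f.natDegree) := by
  have h1 : f.coeff f.natDegree = 1 := hf
  have hd : (derivative f).coeff f.natDegree = 0 := by
    rw [coeff_derivative, coeff_eq_zero_of_natDegree_lt (Nat.lt_succ_self _), zero_mul]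
  have hXd : (X * derivative f).coeff f.natDegree = (f.natDegree : ℂ) := by
    rcases hn : f.natDegree with _ | k
    · simp
    · rw [coeff_X_mul, coeff_derivative, ← hn, h1]
      simp [hn]
  have hcast : (Matrix.of fun i j : Fin 3 => (jacMatrix f i j).coeff f.natDegree) =
      !![(f.natDegree : ℂ), 0, f.natDegree + 4;
         -1, 2 * f.natDegree + 2, 1;
         -1, 0, 1] := by
    have hC (c : ℂ) (r : ℂ[X]) (k : ℕ) : (C c * r).coeff k = c * r.coeff k := coeff_C_mul _
    have h2 (r : ℂ[X]) (k : ℕ) : (2 * r).coeff k = 2 * r.coeff k := hC 2 r k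
    have h4 (r : ℂ[X]) (k : ℕ) : (4 * r).coeff k = 4 * r.coeff k := hC 4 r k
    ext i j
    fin_cases i <;> fin_cases j <;> simp [jacMatrix, mul_assoc, h1, hd, hXd, h2, h4]
  rw [hcast, Matrix.isUnit_iff_isUnit_det, Matrix.det_fin_three, isUnit_iff_ne_zero]
  have : ((2 * f.natDegree + 2) * (2 * f.natDegree + 4) : ℂ) ≠ 0 := by
    exact_mod_cast (by positivity : (2 * f.natDegree + 2) * (2 * f.natDegree + 4) ≠ 0)
  convert this using 1
  simp
  ring

/-- explicit orthogonal polynomials for the 3×3 Jacobi-type weight. -/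
theorem statement_14 (p : ℕ → Polynomial ℂ) (hp : IsJacobiSeq p) :
    IsMOP (Set.Ioo (-1) 1) jacW fun n =>
      !![X * Polynomial.derivative (p n), -2 * Polynomial.derivative (p n),
           X * Polynomial.derivative (p n) + 4 * p n;
         -Polynomial.derivative (p n) - p n,
           2 * X * Polynomial.derivative (p n) + 2 * p n,
           -Polynomial.derivative (p n) + p n;
         -(p n), 0, p n] := by
  change IsMOP _ _ fun n => jacMatrix (p n)
  refine ⟨fun n i j => ?_, fun n => ?_, fun n m i j => ?_, fun n m hnm => ?_⟩
  · exact (natDegree_jacMatrix_le (p n) i j).trans (hp n).2.1.le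
  · have h := isUnit_coeff_jacMatrix (hp n).1
    rwa [(hp n).2.1] at h
  · simp only [evalM_mul_jacW_mul_apply]
    exact integrableOn_eval_mul_sqrtWeight _
  · ext i j
    obtain ⟨a, b, h, hG⟩ := jacMatrix_mul_jacPoly_mul (p n) (p m) i j
    rw [innerW_jacW_apply, hG, Matrix.zero_apply]
    exact hp.sqrtMoment_combination hp.map_conj hnm a b h
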